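/- Let E be a holomorphic vector bundle on a complex manifold M, 𝒰 = {U_0, U_1} an open covering, and φ an invariant polynomial homogeneous of degree k. For Hermitian metrics h_i on E over U_i with associated metric connections ∇_i (i = 0, 1), the cochain φ_BC(∇_*) = (φ(∇_0), φ(∇_1), φ_BC(∇_0, ∇_1)) ∈ E^{k,k}_{BC}(𝒰) is a Čech-Bott-Chern cocycle, and its class [φ_BC(∇_*)] ∈ H^{k,k}_{BC}(𝒰) does not depend on the choice of the metrics h_0 and h_1. -/

import Mathlib

/-!
Statement 15 (from Section 5.4 of the paper, including Proposition 5.10).  Let `E` be a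
holomorphic vector bundle on a complex manifold `M`, `𝒰 = {U₀, U₁}` an open covering, and
`φ` an invariant polynomial homogeneous of degree `k`.  For Hermitian metrics `hᵢ` on `E`
over `Uᵢ` with associated metric connections `∇ᵢ` (`i = 0,1`), the cochain
`φ_BC(∇_*) = (φ(∇₀), φ(∇₁), φ_BC(∇₀,∇₁)) ∈ E^{k,k}_{BC}(𝒰)` is a Čech–Bott–Chern cocycle,
and its class `[φ_BC(∇_*)] ∈ H^{k,k}_{BC}(𝒰)` does not depend on the choice of the
metrics `h₀`, `h₁` (the cocycles for two choices differ by a coboundary).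

The sheaves of forms are modelled abstractly by `DoubleFormSheaf` and the Chern–Weil data
(metrics, Chern forms of metric connections, Bott–Chern difference forms, with their
standard properties) by `CWSheaf`.
-/

open TopologicalSpace

universe u

section LinearHelpers

variable {A B C S : Type u} [AddCommGroup A] [Module ℂ A] [AddCommGroup B] [Module ℂ B]
  [AddCommGroup C] [Module ℂ C] [AddCommGroup S] [Module ℂ S]

/-- a linear map into a triple product -/
def lmTri (f : S →ₗ[ℂ] A) (g : S →ₗ[ℂ] B) (h : S →ₗ[ℂ] C) : S →ₗ[ℂ] A × B × C :=
  LinearMap.prod f (LinearMap.prod g h)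

/-- first projection of a triple product -/
def pA : A × B × C →ₗ[ℂ] A := LinearMap.fst ℂ A (B × C)

/-- second projection of a triple product -/
def pB : A × B × C →ₗ[ℂ] B := (LinearMap.fst ℂ B C).comp (LinearMap.snd ℂ A (B × C))

/-- third projection of a triple product -/
def pC : A × B × C →ₗ[ℂ] C := (LinearMap.snd ℂ B C).comp (LinearMap.snd ℂ A (B × C))

/-- first projection of a pair -/
def qA : A × B →ₗ[ℂ] A := LinearMap.fst ℂ A B

/-- second projection of a pair -/
def qB : A × B →ₗ[ℂ] B := LinearMap.snd ℂ A B

end LinearHelpers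

/-- The cohomology of a pair of composable linear maps `f : A → B`, `g : B → C` with
`g ∘ f = 0` (in the situations where this is used):  `Ker g / Im f`. -/
abbrev cohomOf {A B C : Type u} [AddCommGroup A] [Module ℂ A] [AddCommGroup B] [Module ℂ B]
    [AddCommGroup C] [Module ℂ C] (f : A →ₗ[ℂ] B) (g : B →ₗ[ℂ] C) : Type u :=
  ↥(LinearMap.ker g) ⧸ (Submodule.comap (LinearMap.ker g).subtype (LinearMap.range f))

/-- The cohomology class of a cocycle. -/
def cohomMk {A B C : Type u} [AddCommGroup A] [Module ℂ A] [AddCommGroup B] [Module ℂ B]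
    [AddCommGroup C] [Module ℂ C] (f : A →ₗ[ℂ] B) (g : B →ₗ[ℂ] C) (b : B) (hb : g b = 0) :
    cohomOf f g :=
  Submodule.Quotient.mk ⟨b, LinearMap.mem_ker.mpr hb⟩

/-- The sheaves `E^{p,q}` of `C^∞` differential forms of type `(p,q)` on (the underlying
topological space of) a complex manifold, encoded abstractly: a presheaf of `ℂ`-modules
`E p q U` with the differentials `∂` (`del`) and `∂̄` (`dbar`), satisfying `∂² = ∂̄² = 0`,
`∂∂̄ + ∂̄∂ = 0`, compatibility with restrictions, the sheaf gluing condition for pairs of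
open sets, and the softness property coming from `C^∞` partitions of unity (`pou`). -/
structure DoubleFormSheaf (X : Type u) [TopologicalSpace X] : Type (u + 1) where
  /-- the `ℂ`-module of `(p,q)`-forms on an open set `U` -/
  E : ℤ → ℤ → Opens X → ModuleCat.{u} ℂ
  /-- restriction of forms -/
  res : ∀ (p q : ℤ) ⦃U V : Opens X⦄, U ≤ V → ((E p q V) →ₗ[ℂ] (E p q U))
  res_refl : ∀ (p q : ℤ) (U : Opens X) (x : E p q U), res p q (le_refl U) x = x
  res_res : ∀ (p q : ℤ) ⦃U V W : Opens X⦄ (hUV : U ≤ V) (hVW : V ≤ W) (x : E p q W),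
      res p q hUV (res p q hVW x) = res p q (hUV.trans hVW) x
  /-- the differential `∂` -/
  del : ∀ (p q : ℤ) (U : Opens X), (E p q U) →ₗ[ℂ] (E (p + 1) q U)
  /-- the differential `∂̄` -/
  dbar : ∀ (p q : ℤ) (U : Opens X), (E p q U) →ₗ[ℂ] (E p (q + 1) U)
  del_del : ∀ (p q : ℤ) (U : Opens X) (x : E p q U), del (p + 1) q U (del p q U x) = 0
  dbar_dbar : ∀ (p q : ℤ) (U : Opens X) (x : E p q U), dbar p (q + 1) U (dbar p q U x) = 0
  del_dbar : ∀ (p q : ℤ) (U : Opens X) (x : E p q U),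
      del p (q + 1) U (dbar p q U x) + dbar (p + 1) q U (del p q U x) = 0
  res_del : ∀ (p q : ℤ) ⦃U V : Opens X⦄ (h : U ≤ V) (x : E p q V),
      del p q U (res p q h x) = res (p + 1) q h (del p q V x)
  res_dbar : ∀ (p q : ℤ) ⦃U V : Opens X⦄ (h : U ≤ V) (x : E p q V),
      dbar p q U (res p q h x) = res p (q + 1) h (dbar p q V x)
  /-- sheaf condition: forms agreeing on the overlap glue -/
  glue : ∀ (p q : ℤ) ⦃U V : Opens X⦄ (a : E p q U) (b : E p q V),
      res p q inf_le_left a = res p q inf_le_right b →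
      ∃! c : E p q (U ⊔ V), res p q le_sup_left c = a ∧ res p q le_sup_right c = b
  /-- softness coming from `C^∞` partitions of unity subordinate to a two-set open cover:
  "multiplication by `ρ₁` (resp. `ρ₀`) followed by extension by zero" operators. -/
  pou : ∀ ⦃U V : Opens X⦄, U ⊔ V = ⊤ →
      ∃ (z₀ : ∀ p q : ℤ, ((E p q (U ⊓ V)) →ₗ[ℂ] (E p q U)))
        (z₁ : ∀ p q : ℤ, ((E p q (U ⊓ V)) →ₗ[ℂ] (E p q V))),
        ∀ (p q : ℤ) (x : E p q (U ⊓ V)),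
          res p q inf_le_left (z₀ p q x) + res p q inf_le_right (z₁ p q x) = x

namespace DoubleFormSheaf

variable {X : Type u} [TopologicalSpace X] (F : DoubleFormSheaf X)

/-- identification of the modules of forms in equal bidegrees -/
def cast (U : Opens X) :
    ∀ {p q p' q' : ℤ}, p = p' → q = q' → ((F.E p q U) →ₗ[ℂ] (F.E p' q' U))
  | _, _, _, _, rfl, rfl => LinearMap.id

section Cech

variable (U₀ U₁ : Opens X)

/-- Čech–Bott–Chern cochains `E^{p,q}_{BC}(𝒰) = E^{p,q}(U₀) ⊕ E^{p,q}(U₁) ⊕ E^{p-1,q-1}(U₀₁)` -/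
abbrev TBC (p q : ℤ) : Type u :=
  ↥(F.E p q U₀) × ↥(F.E p q U₁) × ↥(F.E (p - 1) (q - 1) (U₀ ⊓ U₁))

/-- Čech–Aeppli cochains
`E^{p,q}_{A}(𝒰) = E^{p,q}(U₀) ⊕ E^{p,q}(U₁) ⊕ E^{(p-1,q-1)+1}(U₀₁)`,
`E^{(p-1,q-1)+1} = E^{p,q-1} ⊕ E^{p-1,q}` -/
abbrev TA (p q : ℤ) : Type u :=
  ↥(F.E p q U₀) × ↥(F.E p q U₁) ×
    (↥(F.E p (q - 1) (U₀ ⊓ U₁)) × ↥(F.E (p - 1) q (U₀ ⊓ U₁)))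

/-- Čech cochains of the third type
`E^{(p,q)+1}(𝒰) = E^{(p,q)+1}(U₀) ⊕ E^{(p,q)+1}(U₁) ⊕ E^{p,q}(U₀₁)`,
`E^{(p,q)+1} = E^{p+1,q} ⊕ E^{p,q+1}` -/
abbrev TT (p q : ℤ) : Type u :=
  (↥(F.E (p + 1) q U₀) × ↥(F.E p (q + 1) U₀)) ×
    (↥(F.E (p + 1) q U₁) × ↥(F.E p (q + 1) U₁)) × ↥(F.E p q (U₀ ⊓ U₁))

/-- Čech–Dolbeault cochains `E^{p,q}(𝒰) = E^{p,q}(U₀) ⊕ E^{p,q}(U₁) ⊕ E^{p,q-1}(U₀₁)` -/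
abbrev TD (p q : ℤ) : Type u :=
  ↥(F.E p q U₀) × ↥(F.E p q U₁) × ↥(F.E p (q - 1) (U₀ ⊓ U₁))

/-- relative Čech–Bott–Chern cochains `E^{p,q}_{BC}(𝒰, U₀) = E^{p,q}(U₁) ⊕ E^{p-1,q-1}(U₀₁)` -/
abbrev RBC (p q : ℤ) : Type u :=
  ↥(F.E p q U₁) × ↥(F.E (p - 1) (q - 1) (U₀ ⊓ U₁))

/-- relative Čech–Aeppli cochains `E^{p,q}_{A}(𝒰, U₀) = E^{p,q}(U₁) ⊕ E^{(p-1,q-1)+1}(U₀₁)` -/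
abbrev RA (p q : ℤ) : Type u :=
  ↥(F.E p q U₁) × (↥(F.E p (q - 1) (U₀ ⊓ U₁)) × ↥(F.E (p - 1) q (U₀ ⊓ U₁)))

/-- relative Čech cochains of the third type `E^{(p,q)+1}(𝒰, U₀) = E^{(p,q)+1}(U₁) ⊕ E^{p,q}(U₀₁)` -/
abbrev RT (p q : ℤ) : Type u :=
  (↥(F.E (p + 1) q U₁) × ↥(F.E p (q + 1) U₁)) × ↥(F.E p q (U₀ ⊓ U₁))

/-- relative Čech–Dolbeault cochains `E^{p,q}(𝒰, U₀) = E^{p,q}(U₁) ⊕ E^{p,q-1}(U₀₁)` -/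
abbrev RD (p q : ℤ) : Type u :=
  ↥(F.E p q U₁) × ↥(F.E p (q - 1) (U₀ ⊓ U₁))

/-- the Čech differential `E^{p,q}_{BC}(𝒰) → E^{(p,q)+1}(𝒰)`,
`σ ↦ ((∂σ₀, ∂̄σ₀), (∂σ₁, ∂̄σ₁), σ₁ - σ₀ - ∂̄∂σ₀₁)` (i.e. `σ ↦ (dσ₀, dσ₁, σ₁ - σ₀ - ∂̄∂σ₀₁)`) -/
def DtoTT (p q : ℤ) : TBC F U₀ U₁ p q →ₗ[ℂ] TT F U₀ U₁ p q :=
  lmTri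
    (LinearMap.prod ((F.del p q U₀).comp pA) ((F.dbar p q U₀).comp pA))
    (LinearMap.prod ((F.del p q U₁).comp pB) ((F.dbar p q U₁).comp pB))
    (((F.res p q inf_le_right).comp pB - (F.res p q inf_le_left).comp pA) -
      ((F.cast (U₀ ⊓ U₁) (show p - 1 + 1 = p by ring) (show q - 1 + 1 = q by ring)).comp
        ((F.dbar (p - 1 + 1) (q - 1) (U₀ ⊓ U₁)).comp
          ((F.del (p - 1) (q - 1) (U₀ ⊓ U₁)).comp pC))))

/-- the Čech differential `E^{(p,q)+1}(𝒰) → E^{p+1,q+1}_{A?}(𝒰)`; more precisely the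
differential `E^{(p,q)+1}(𝒰) → E^{p+1,q+1}(𝒰)`-component of the mixed complex, landing in
the Aeppli-type cochains `E^{p+1,q+1}_{A}(𝒰)`:
`((α₀,β₀), (α₁,β₁), γ) ↦ (∂̄α₀ + ∂β₀, ∂̄α₁ + ∂β₁, (α₁ - α₀ - ∂γ, β₁ - β₀ - ∂̄γ))` -/
def DtoTA (p q : ℤ) : TT F U₀ U₁ p q →ₗ[ℂ] TA F U₀ U₁ (p + 1) (q + 1) :=
  lmTri
    (((F.dbar (p + 1) q U₀).comp (qA.comp pA)) + ((F.del p (q + 1) U₀).comp (qB.comp pA)))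
    (((F.dbar (p + 1) q U₁).comp (qA.comp pB)) + ((F.del p (q + 1) U₁).comp (qB.comp pB)))
    (LinearMap.prod
      ((F.cast (U₀ ⊓ U₁) rfl (show q = q + 1 - 1 by ring)).comp
        (((F.res (p + 1) q inf_le_right).comp (qA.comp pB) -
            (F.res (p + 1) q inf_le_left).comp (qA.comp pA)) -
          ((F.del p q (U₀ ⊓ U₁)).comp pC)))
      ((F.cast (U₀ ⊓ U₁) (show p = p + 1 - 1 by ring) rfl).comp
        (((F.res p (q + 1) inf_le_right).comp (qB.comp pB) -
            (F.res p (q + 1) inf_le_left).comp (qB.comp pA)) -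
          ((F.dbar p q (U₀ ⊓ U₁)).comp pC))))

/-- the Čech differential `E^{p,q}_{A}(𝒰) → E^{p+1,q+1}_{BC}(𝒰)`:
`(ξ₀, ξ₁, (η₁, η₂)) ↦ (∂̄∂ξ₀, ∂̄∂ξ₁, ξ₁ - ξ₀ - ∂̄η₁ - ∂η₂)` -/
def DtoTBC (p q : ℤ) : TA F U₀ U₁ p q →ₗ[ℂ] TBC F U₀ U₁ (p + 1) (q + 1) :=
  lmTri
    ((F.dbar (p + 1) q U₀).comp ((F.del p q U₀).comp pA))
    ((F.dbar (p + 1) q U₁).comp ((F.del p q U₁).comp pB))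
    ((F.cast (U₀ ⊓ U₁) (show p = p + 1 - 1 by ring) (show q = q + 1 - 1 by ring)).comp
      ((((F.res p q inf_le_right).comp pB - (F.res p q inf_le_left).comp pA) -
          ((F.cast (U₀ ⊓ U₁) rfl (show q - 1 + 1 = q by ring)).comp
            ((F.dbar p (q - 1) (U₀ ⊓ U₁)).comp (qA.comp pC)))) -
        ((F.cast (U₀ ⊓ U₁) (show p - 1 + 1 = p by ring) rfl).comp
          ((F.del (p - 1) q (U₀ ⊓ U₁)).comp (qB.comp pC)))))

/-- the Čech–Dolbeault differential `∂̄ϑ σ = (∂̄σ₀, ∂̄σ₁, σ₁ - σ₀ - ∂̄σ₀₁)` -/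
def DD (p q : ℤ) : TD F U₀ U₁ p q →ₗ[ℂ] TD F U₀ U₁ p (q + 1) :=
  lmTri
    ((F.dbar p q U₀).comp pA)
    ((F.dbar p q U₁).comp pB)
    (((F.cast (U₀ ⊓ U₁) rfl (show q = q + 1 - 1 by ring)).comp
        ((F.res p q inf_le_right).comp pB - (F.res p q inf_le_left).comp pA)) -
      ((F.cast (U₀ ⊓ U₁) rfl (show q - 1 + 1 = q + 1 - 1 by ring)).comp
        ((F.dbar p (q - 1) (U₀ ⊓ U₁)).comp pC)))

/-- the relative Čech differential `E^{p,q}_{BC}(𝒰,U₀) → E^{(p,q)+1}(𝒰,U₀)` -/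
def RtoTT (p q : ℤ) : RBC F U₀ U₁ p q →ₗ[ℂ] RT F U₀ U₁ p q :=
  LinearMap.prod
    (LinearMap.prod ((F.del p q U₁).comp qA) ((F.dbar p q U₁).comp qA))
    (((F.res p q inf_le_right).comp qA) -
      ((F.cast (U₀ ⊓ U₁) (show p - 1 + 1 = p by ring) (show q - 1 + 1 = q by ring)).comp
        ((F.dbar (p - 1 + 1) (q - 1) (U₀ ⊓ U₁)).comp
          ((F.del (p - 1) (q - 1) (U₀ ⊓ U₁)).comp qB))))

/-- the relative Čech differential `E^{(p,q)+1}(𝒰,U₀) → E^{p+1,q+1}_{A}(𝒰,U₀)` -/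
def RtoTA (p q : ℤ) : RT F U₀ U₁ p q →ₗ[ℂ] RA F U₀ U₁ (p + 1) (q + 1) :=
  LinearMap.prod
    (((F.dbar (p + 1) q U₁).comp (qA.comp qA)) + ((F.del p (q + 1) U₁).comp (qB.comp qA)))
    (LinearMap.prod
      ((F.cast (U₀ ⊓ U₁) rfl (show q = q + 1 - 1 by ring)).comp
        (((F.res (p + 1) q inf_le_right).comp (qA.comp qA)) -
          ((F.del p q (U₀ ⊓ U₁)).comp qB)))
      ((F.cast (U₀ ⊓ U₁) (show p = p + 1 - 1 by ring) rfl).comp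
        (((F.res p (q + 1) inf_le_right).comp (qB.comp qA)) -
          ((F.dbar p q (U₀ ⊓ U₁)).comp qB))))

/-- the relative Čech differential `E^{p,q}_{A}(𝒰,U₀) → E^{p+1,q+1}_{BC}(𝒰,U₀)` -/
def RtoTBC (p q : ℤ) : RA F U₀ U₁ p q →ₗ[ℂ] RBC F U₀ U₁ (p + 1) (q + 1) :=
  LinearMap.prod
    ((F.dbar (p + 1) q U₁).comp ((F.del p q U₁).comp qA))
    ((F.cast (U₀ ⊓ U₁) (show p = p + 1 - 1 by ring) (show q = q + 1 - 1 by ring)).comp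
      ((((F.res p q inf_le_right).comp qA) -
          ((F.cast (U₀ ⊓ U₁) rfl (show q - 1 + 1 = q by ring)).comp
            ((F.dbar p (q - 1) (U₀ ⊓ U₁)).comp (qA.comp qB)))) -
        ((F.cast (U₀ ⊓ U₁) (show p - 1 + 1 = p by ring) rfl).comp
          ((F.del (p - 1) q (U₀ ⊓ U₁)).comp (qB.comp qB)))))

/-- the relative Čech–Dolbeault differential -/
def DrD (p q : ℤ) : RD F U₀ U₁ p q →ₗ[ℂ] RD F U₀ U₁ p (q + 1) :=
  LinearMap.prod
    ((F.dbar p q U₁).comp qA)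
    (((F.cast (U₀ ⊓ U₁) rfl (show q = q + 1 - 1 by ring)).comp
        ((F.res p q inf_le_right).comp qA)) -
      ((F.cast (U₀ ⊓ U₁) rfl (show q - 1 + 1 = q + 1 - 1 by ring)).comp
        ((F.dbar p (q - 1) (U₀ ⊓ U₁)).comp qB)))

/-- identification of Čech–Bott–Chern cochains in equal bidegrees -/
def castTBC {p q p' q' : ℤ} (hp : p = p') (hq : q = q') :
    TBC F U₀ U₁ p q →ₗ[ℂ] TBC F U₀ U₁ p' q' :=
  lmTri ((F.cast U₀ hp hq).comp pA) ((F.cast U₁ hp hq).comp pB)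
    ((F.cast _ (by rw [hp]) (by rw [hq])).comp pC)

/-- identification of Čech–Aeppli cochains in equal bidegrees -/
def castTA {p q p' q' : ℤ} (hp : p = p') (hq : q = q') :
    TA F U₀ U₁ p q →ₗ[ℂ] TA F U₀ U₁ p' q' :=
  lmTri ((F.cast U₀ hp hq).comp pA) ((F.cast U₁ hp hq).comp pB)
    (LinearMap.prod ((F.cast _ hp (by rw [hq])).comp (qA.comp pC))
      ((F.cast _ (by rw [hp]) hq).comp (qB.comp pC)))

/-- identification of Čech–Dolbeault cochains in equal bidegrees -/
def castTD {p q p' q' : ℤ} (hp : p = p') (hq : q = q') :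
    TD F U₀ U₁ p q →ₗ[ℂ] TD F U₀ U₁ p' q' :=
  lmTri ((F.cast U₀ hp hq).comp pA) ((F.cast U₁ hp hq).comp pB)
    ((F.cast _ hp (by rw [hq])).comp pC)

/-- identification of relative Čech–Bott–Chern cochains in equal bidegrees -/
def castRBC {p q p' q' : ℤ} (hp : p = p') (hq : q = q') :
    RBC F U₀ U₁ p q →ₗ[ℂ] RBC F U₀ U₁ p' q' :=
  LinearMap.prod ((F.cast U₁ hp hq).comp qA)
    ((F.cast _ (by rw [hp]) (by rw [hq])).comp qB)

/-- identification of relative Čech–Aeppli cochains in equal bidegrees -/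
def castRA {p q p' q' : ℤ} (hp : p = p') (hq : q = q') :
    RA F U₀ U₁ p q →ₗ[ℂ] RA F U₀ U₁ p' q' :=
  LinearMap.prod ((F.cast U₁ hp hq).comp qA)
    (LinearMap.prod ((F.cast _ hp (by rw [hq])).comp (qA.comp qB))
      ((F.cast _ (by rw [hp]) hq).comp (qB.comp qB)))

/-- identification of relative Čech–Dolbeault cochains in equal bidegrees -/
def castRD {p q p' q' : ℤ} (hp : p = p') (hq : q = q') :
    RD F U₀ U₁ p q →ₗ[ℂ] RD F U₀ U₁ p' q' :=
  LinearMap.prod ((F.cast U₁ hp hq).comp qA)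
    ((F.cast _ hp (by rw [hq])).comp qB)

/-- the Čech–Bott–Chern cohomology `H^{p,q}_{BC}(𝒰)` -/
abbrev HBCcech (p q : ℤ) : Type u :=
  cohomOf
    ((castTBC F U₀ U₁ (show p - 1 + 1 = p by ring) (show q - 1 + 1 = q by ring)).comp
      (DtoTBC F U₀ U₁ (p - 1) (q - 1)))
    (DtoTT F U₀ U₁ p q)

/-- the Čech–Aeppli cohomology `H^{p,q}_{A}(𝒰)` -/
abbrev HAcech (p q : ℤ) : Type u :=
  cohomOf
    ((castTA F U₀ U₁ (show p - 1 + 1 = p by ring) (show q - 1 + 1 = q by ring)).comp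
      (DtoTA F U₀ U₁ (p - 1) (q - 1)))
    (DtoTBC F U₀ U₁ p q)

/-- the Čech cohomology of the third type `H^{(p,q)+1}(𝒰)` -/
abbrev HTcech (p q : ℤ) : Type u :=
  cohomOf (DtoTT F U₀ U₁ p q) (DtoTA F U₀ U₁ p q)

/-- the Čech–Dolbeault cohomology `H^{p,q}_{∂̄ϑ}(𝒰)` -/
abbrev HDcech (p q : ℤ) : Type u :=
  cohomOf ((castTD F U₀ U₁ rfl (show q - 1 + 1 = q by ring)).comp (DD F U₀ U₁ p (q - 1)))
    (DD F U₀ U₁ p q)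

/-- the relative Bott–Chern cohomology `H^{p,q}_{BC}(𝒰, U₀)` -/
abbrev HBCrel (p q : ℤ) : Type u :=
  cohomOf
    ((castRBC F U₀ U₁ (show p - 1 + 1 = p by ring) (show q - 1 + 1 = q by ring)).comp
      (RtoTBC F U₀ U₁ (p - 1) (q - 1)))
    (RtoTT F U₀ U₁ p q)

/-- the relative Aeppli cohomology `H^{p,q}_{A}(𝒰, U₀)` -/
abbrev HArel (p q : ℤ) : Type u :=
  cohomOf
    ((castRA F U₀ U₁ (show p - 1 + 1 = p by ring) (show q - 1 + 1 = q by ring)).comp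
      (RtoTA F U₀ U₁ (p - 1) (q - 1)))
    (RtoTBC F U₀ U₁ p q)

/-- the relative cohomology of the third type `H^{(p,q)+1}(𝒰, U₀)` -/
abbrev HTrel (p q : ℤ) : Type u :=
  cohomOf (RtoTT F U₀ U₁ p q) (RtoTA F U₀ U₁ p q)

/-- the relative Dolbeault cohomology `H^{p,q}_{∂̄ϑ}(𝒰, U₀)` -/
abbrev HDrel (p q : ℤ) : Type u :=
  cohomOf ((castRD F U₀ U₁ rfl (show q - 1 + 1 = q by ring)).comp (DrD F U₀ U₁ p (q - 1)))
    (DrD F U₀ U₁ p q)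

end Cech

section OpenSet

variable (W : Opens X)

/-- the differential `∂̄ + ∂ : E^{(p-1,q-1)+1}(W) → E^{p,q}(W)`, `(η₁, η₂) ↦ ∂̄η₁ + ∂η₂` -/
def plusW (p q : ℤ) :
    (↥(F.E p (q - 1) W) × ↥(F.E (p - 1) q W)) →ₗ[ℂ] ↥(F.E p q W) :=
  ((F.cast W rfl (show q - 1 + 1 = q by ring)).comp ((F.dbar p (q - 1) W).comp qA)) +
    ((F.cast W (show p - 1 + 1 = p by ring) rfl).comp ((F.del (p - 1) q W).comp qB))

/-- the differential `∂̄∂ : E^{p,q}(W) → E^{p+1,q+1}(W)` -/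
def ddbarW (p q : ℤ) : ↥(F.E p q W) →ₗ[ℂ] ↥(F.E (p + 1) (q + 1) W) :=
  (F.dbar (p + 1) q W).comp (F.del p q W)

/-- the differential `d : E^{p,q}(W) → E^{(p,q)+1}(W)`, `ω ↦ (∂ω, ∂̄ω)` -/
def dfullW (p q : ℤ) :
    ↥(F.E p q W) →ₗ[ℂ] (↥(F.E (p + 1) q W) × ↥(F.E p (q + 1) W)) :=
  LinearMap.prod (F.del p q W) (F.dbar p q W)

/-- the differential `∂̄ + ∂ : E^{(p,q)+1}(W) → E^{p+1,q+1}(W)`, `(α, β) ↦ ∂̄α + ∂β` -/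
def plusTW (p q : ℤ) :
    (↥(F.E (p + 1) q W) × ↥(F.E p (q + 1) W)) →ₗ[ℂ] ↥(F.E (p + 1) (q + 1) W) :=
  ((F.dbar (p + 1) q W).comp qA) + ((F.del p (q + 1) W).comp qB)

/-- the Bott–Chern cohomology `H^{p,q}_{BC}(W)` of an open set `W` -/
abbrev HBCopen (p q : ℤ) : Type u :=
  cohomOf
    ((F.cast W (show p - 1 + 1 = p by ring) (show q - 1 + 1 = q by ring)).comp
      (ddbarW F W (p - 1) (q - 1)))
    (dfullW F W p q)

/-- the Aeppli cohomology `H^{p,q}_{A}(W)` of an open set `W` -/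
abbrev HAopen (p q : ℤ) : Type u :=
  cohomOf (plusW F W p q) (ddbarW F W p q)

/-- the cohomology of the third type `H^{(p,q)+1}(W)` of an open set `W` -/
abbrev HTopen (p q : ℤ) : Type u :=
  cohomOf (dfullW F W p q) (plusTW F W p q)

/-- the Dolbeault cohomology `H^{p,q}_{∂̄}(W)` of an open set `W` -/
abbrev HDopen (p q : ℤ) : Type u :=
  cohomOf ((F.cast W rfl (show q - 1 + 1 = q by ring)).comp (F.dbar p (q - 1) W))
    (F.dbar p q W)

end OpenSet

section Tilde

variable (U₀ U₁ : Opens X)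

/-- the map `ω ↦ (ω|_{U₀}, ω|_{U₁}, 0)` into Čech–Bott–Chern cochains -/
def tBC (p q : ℤ) : ↥(F.E p q ⊤) →ₗ[ℂ] TBC F U₀ U₁ p q :=
  lmTri (F.res p q le_top) (F.res p q le_top) 0

/-- the map `ω ↦ (ω|_{U₀}, ω|_{U₁}, 0, 0)` into Čech–Aeppli cochains -/
def tA (p q : ℤ) : ↥(F.E p q ⊤) →ₗ[ℂ] TA F U₀ U₁ p q :=
  lmTri (F.res p q le_top) (F.res p q le_top) 0

/-- the map `ω ↦ (ω|_{U₀}, ω|_{U₁}, 0)` into Čech–Dolbeault cochains -/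
def tD (p q : ℤ) : ↥(F.E p q ⊤) →ₗ[ℂ] TD F U₀ U₁ p q :=
  lmTri (F.res p q le_top) (F.res p q le_top) 0

end Tilde

end DoubleFormSheaf

/-- Chern–Weil data for a holomorphic vector bundle `E` over a complex manifold, at the
sheaf level: invariant homogeneous polynomials, Hermitian metrics over open sets with
restriction, the Chern forms `φ(∇^h)` of the associated metric connections (`(k,k)`-forms,
`k = deg φ`, simultaneously `d`- and `∂̄`-closed), and the Bott–Chern difference forms
`φ_BC(∇^{h₀}, ∇^{h₁})` with `∂̄∂ φ_BC(∇^{h₀}, ∇^{h₁}) = φ(∇^{h₁}) - φ(∇^{h₀})` and the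
triple identity, the standard facts being recorded as axioms. -/
structure CWSheaf {X : Type u} [TopologicalSpace X] (F : DoubleFormSheaf X) :
    Type (u + 1) where
  /-- invariant homogeneous polynomials -/
  Poly : Type u
  /-- the degree of an invariant homogeneous polynomial -/
  deg : Poly → ℕ
  /-- Hermitian metrics on `E` over an open set -/
  Metric : Opens X → Type u
  /-- restriction of metrics -/
  resM : ∀ ⦃U V : Opens X⦄, U ≤ V → Metric V → Metric U
  /-- every holomorphic vector bundle admits a Hermitian metric -/
  metric_nonempty : ∀ U, Nonempty (Metric U)
  /-- the Chern form `φ(∇^h)` of the `h`-metric connection, a `(k,k)`-form -/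
  chern : ∀ (φ : Poly) (U : Opens X), Metric U → (F.E (deg φ : ℤ) (deg φ : ℤ) U)
  chern_res : ∀ (φ : Poly) ⦃U V : Opens X⦄ (h : U ≤ V) (m : Metric V),
      F.res _ _ h (chern φ V m) = chern φ U (resM h m)
  chern_del : ∀ (φ : Poly) (U : Opens X) (m : Metric U),
      F.del (deg φ : ℤ) (deg φ : ℤ) U (chern φ U m) = 0
  chern_dbar : ∀ (φ : Poly) (U : Opens X) (m : Metric U),
      F.dbar (deg φ : ℤ) (deg φ : ℤ) U (chern φ U m) = 0
  /-- the Bott–Chern difference form `φ_BC(∇^{h₀}, ∇^{h₁})`, a `(k-1,k-1)`-form -/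
  bcDiff : ∀ (φ : Poly) (U : Opens X), Metric U → Metric U →
      (F.E ((deg φ : ℤ) - 1) ((deg φ : ℤ) - 1) U)
  bcDiff_res : ∀ (φ : Poly) ⦃U V : Opens X⦄ (h : U ≤ V) (m₀ m₁ : Metric V),
      F.res _ _ h (bcDiff φ V m₀ m₁) = bcDiff φ U (resM h m₀) (resM h m₁)
  /-- `∂̄∂ φ_BC(∇^{h₀}, ∇^{h₁}) = φ(∇^{h₁}) - φ(∇^{h₀})` -/
  bcDiff_ddbar : ∀ (φ : Poly) (U : Opens X) (m₀ m₁ : Metric U),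
      F.cast U (show (deg φ : ℤ) - 1 + 1 = (deg φ : ℤ) by ring)
          (show (deg φ : ℤ) - 1 + 1 = (deg φ : ℤ) by ring)
          (F.dbar ((deg φ : ℤ) - 1 + 1) ((deg φ : ℤ) - 1) U
            (F.del ((deg φ : ℤ) - 1) ((deg φ : ℤ) - 1) U (bcDiff φ U m₀ m₁)))
        = chern φ U m₁ - chern φ U m₀
  /-- for three metric connections there are forms `φ⁽¹⁾`, `φ⁽²⁾` with
  `φ_BC(∇',∇'') - φ_BC(∇,∇'') + φ_BC(∇,∇') + ∂̄φ⁽¹⁾ + ∂φ⁽²⁾ = 0` -/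
  bc_triple : ∀ (φ : Poly) (U : Opens X) (m m' m'' : Metric U),
      ∃ (A : F.E ((deg φ : ℤ) - 1) ((deg φ : ℤ) - 2) U)
        (B : F.E ((deg φ : ℤ) - 2) ((deg φ : ℤ) - 1) U),
        bcDiff φ U m' m'' - bcDiff φ U m m'' + bcDiff φ U m m'
            + F.cast U rfl (show (deg φ : ℤ) - 2 + 1 = (deg φ : ℤ) - 1 by ring)
                (F.dbar ((deg φ : ℤ) - 1) ((deg φ : ℤ) - 2) U A)
            + F.cast U (show (deg φ : ℤ) - 2 + 1 = (deg φ : ℤ) - 1 by ring) rfl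
                (F.del ((deg φ : ℤ) - 2) ((deg φ : ℤ) - 1) U B)
          = 0


open DoubleFormSheaf

namespace DoubleFormSheaf

variable {X : Type u} [TopologicalSpace X] (F : DoubleFormSheaf X) (U : Opens X)

lemma cast_self_apply {p q : ℤ} (hp : p = p) (hq : q = q) (x : F.E p q U) :
    F.cast U hp hq x = x := rfl

lemma cast_cast_apply {p q p' q' p'' q'' : ℤ} (hp : p = p') (hq : q = q') (hp' : p' = p'')
    (hq' : q' = q'') (x : F.E p q U) :
    F.cast U hp' hq' (F.cast U hp hq x) = F.cast U (hp.trans hp') (hq.trans hq') x := by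
  subst hp hq hp' hq'
  rfl

lemma del_cast {p q p' q' : ℤ} (hp : p = p') (hq : q = q') (x : F.E p q U) :
    F.del p' q' U (F.cast U hp hq x) = F.cast U (by rw [hp]) hq (F.del p q U x) := by
  subst hp hq
  rfl

lemma dbar_cast {p q p' q' : ℤ} (hp : p = p') (hq : q = q') (x : F.E p q U) :
    F.dbar p' q' U (F.cast U hp hq x) = F.cast U hp (by rw [hq]) (F.dbar p q U x) := by
  subst hp hq
  rfl

end DoubleFormSheaf

/-- `φ_BC(∇_*) = (φ(∇₀), φ(∇₁), φ_BC(∇₀,∇₁))` is a Čech–Bott–Chern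
cocycle whose class in `H^{k,k}_{BC}(𝒰)` is independent of the chosen metrics. -/
theorem statement15 {X : Type u} [TopologicalSpace X] (F : DoubleFormSheaf X)
    (C : CWSheaf F) (U₀ U₁ : Opens X) (hcov : U₀ ⊔ U₁ = ⊤) (φ : C.Poly) :
    letI k : ℤ := (C.deg φ : ℤ)
    letI coc : C.Metric U₀ → C.Metric U₁ → TBC F U₀ U₁ k k := fun m₀ m₁ =>
      (C.chern φ U₀ m₀, C.chern φ U₁ m₁,
        C.bcDiff φ (U₀ ⊓ U₁) (C.resM inf_le_left m₀) (C.resM inf_le_right m₁))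
    ∀ (m₀ : C.Metric U₀) (m₁ : C.Metric U₁),
      -- `φ_BC(∇_*)` is a cocycle …
      DtoTT F U₀ U₁ k k (coc m₀ m₁) = 0 ∧
      -- … and its Čech–Bott–Chern cohomology class does not depend on the metrics
      ∀ (m₀' : C.Metric U₀) (m₁' : C.Metric U₁),
        coc m₀' m₁' - coc m₀ m₁ ∈
          Set.range
            ((castTBC F U₀ U₁ (show k - 1 + 1 = k by ring) (show k - 1 + 1 = k by ring)).comp
              (DtoTBC F U₀ U₁ (k - 1) (k - 1))) := by
  intro m₀ m₁
  refine ⟨?_, fun m₀' m₁' => ?_⟩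
  · have h := C.bcDiff_ddbar φ (U₀ ⊓ U₁) (C.resM inf_le_left m₀) (C.resM inf_le_right m₁)
    simp [DtoTT, lmTri, pA, pB, pC, C.chern_del, C.chern_dbar, C.chern_res, h]
  · obtain ⟨A, B, hAB⟩ := C.bc_triple φ (U₀ ⊓ U₁) (C.resM inf_le_left m₀)
      (C.resM inf_le_right m₁) (C.resM inf_le_right m₁')
    obtain ⟨A', B', hAB'⟩ := C.bc_triple φ (U₀ ⊓ U₁) (C.resM inf_le_left m₀)
      (C.resM inf_le_left m₀') (C.resM inf_le_right m₁')
    have e : (C.deg φ : ℤ) - 2 = (C.deg φ : ℤ) - 1 - 1 := by ring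
    refine ⟨(C.bcDiff φ U₀ m₀ m₀', C.bcDiff φ U₁ m₁ m₁',
        (F.cast _ rfl e (A' - A), F.cast _ e rfl (B' - B))),
      Prod.ext (C.bcDiff_ddbar φ U₀ m₀ m₀') (Prod.ext (C.bcDiff_ddbar φ U₁ m₁ m₁') ?_)⟩
    change F.cast _ _ _ (F.cast _ _ _ (F.res _ _ _ (C.bcDiff _ _ _ _) -
      F.res _ _ _ (C.bcDiff _ _ _ _) -
      F.cast _ _ _ (F.dbar _ _ _ (F.cast _ _ _ _)) -
      F.cast _ _ _ (F.del _ _ _ (F.cast _ _ _ _)))) = C.bcDiff _ _ _ _ - C.bcDiff _ _ _ _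
    rw [cast_cast_apply, cast_self_apply, C.bcDiff_res, C.bcDiff_res, dbar_cast, del_cast,
      cast_cast_apply, cast_cast_apply]
    simp only [map_sub]
    rw [← sub_eq_zero, ← sub_eq_zero_of_eq (hAB.trans hAB'.symm)]
    abel
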